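/- Fix J>0, β>0, S>0, a probability distribution P_h supported on [-S,S], n≥1, t∈[0,1], and s_n∈(0,1/2]. For ε∈[s_n,2s_n] let R_ε(t)∈ℝ and assume ε↦R_ε(t) is regular (a C¹ diffeomorphism with Jacobian ≥1). With i.i.d. fields h_i∼P_h, the interpolating Hamiltonian H_{t,ε}(σ;h) = (1-t)(-(J/n)Σ_{i<j}σ_iσ_j) - J R_ε(t)Σ_iσ_i - Σ_i h_iσ_i, Gibbs bracket ⟨-⟩_{t,ε} and magnetization M = (1/n)Σσ_i, one has ∫_{s_n}^{2s_n} dε E⟨(M - ⟨M⟩_{t,ε})²⟩_{t,ε} ≤ 2/(βJn). -/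

import Mathlib

open Finset MeasureTheory

/-- spin value of a Boolean configuration entry: `true ↦ 1`, `false ↦ -1`. -/
noncomputable def spin (b : Bool) : ℝ := if b then 1 else -1

/-- `∑_{i<j} σ_i σ_j`. -/
noncomputable def pairSum (n : ℕ) (σ : Fin n → Bool) : ℝ :=
  ∑ i : Fin n, ∑ j ∈ Finset.univ.filter (fun j => i < j), spin (σ i) * spin (σ j)

/-- `∑_i σ_i`. -/
noncomputable def magSum (n : ℕ) (σ : Fin n → Bool) : ℝ :=
  ∑ i : Fin n, spin (σ i)

/-- Interpolating Hamiltonian for the Curie-Weiss model with random external fields: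
`H_{t,R}(σ;h) = (1-t)(-(J/n)Σ_{i<j}σ_iσ_j) - J R Σ_i σ_i - Σ_i h_iσ_i`. -/
noncomputable def Hrcw (J : ℝ) (n : ℕ) (t R : ℝ) (hs : Fin n → ℝ) (σ : Fin n → Bool) : ℝ :=
  (1 - t) * (-(J / n) * pairSum n σ) - J * R * magSum n σ - ∑ i : Fin n, hs i * spin (σ i)

/-- Gibbs expectation `⟨A⟩_{t,R}` for the random-field interpolating model (at fixed
realization `hs` of the external fields). -/
noncomputable def gibbsRCW (J β : ℝ) (n : ℕ) (t R : ℝ) (hs : Fin n → ℝ)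
    (A : (Fin n → Bool) → ℝ) : ℝ :=
  (∑ σ : Fin n → Bool, A σ * Real.exp (-(β * Hrcw J n t R hs σ))) /
  (∑ σ : Fin n → Bool, Real.exp (-(β * Hrcw J n t R hs σ)))

/-- Magnetization `M(σ) = (1/n) Σ_i σ_i`. -/
noncomputable def mag (n : ℕ) (σ : Fin n → Bool) : ℝ := magSum n σ / n

lemma abs_spin (b : Bool) : |spin b| = 1 := by
  cases b <;> simp [spin]

lemma abs_mag_le_one (n : ℕ) (σ : Fin n → Bool) : |mag n σ| ≤ 1 := by
  have h : |magSum n σ| ≤ n := by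
    refine (Finset.abs_sum_le_sum_abs _ _).trans ?_
    simp [abs_spin]
  rw [mag, abs_div, Nat.abs_cast]
  exact div_le_one_of_le₀ h (Nat.cast_nonneg n)

lemma partition_pos (J β : ℝ) (n : ℕ) (t R : ℝ) (hs : Fin n → ℝ) :
    0 < ∑ σ : Fin n → Bool, Real.exp (-(β * Hrcw J n t R hs σ)) :=
  Finset.sum_pos (fun _ _ => Real.exp_pos _) Finset.univ_nonempty

lemma abs_gibbsRCW_le (J β : ℝ) (n : ℕ) (t R : ℝ) (hs : Fin n → ℝ)
    (A : (Fin n → Bool) → ℝ) (C : ℝ) (hA : ∀ σ, |A σ| ≤ C) :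
    |gibbsRCW J β n t R hs A| ≤ C := by
  have hZ := partition_pos J β n t R hs
  rw [gibbsRCW, abs_div, abs_of_pos hZ, div_le_iff₀ hZ, Finset.mul_sum]
  refine (Finset.abs_sum_le_sum_abs _ _).trans (Finset.sum_le_sum fun σ _ => ?_)
  rw [abs_mul, Real.abs_exp]
  exact mul_le_mul_of_nonneg_right (hA σ) (Real.exp_pos _).le

lemma gibbsRCW_nonneg (J β : ℝ) (n : ℕ) (t R : ℝ) (hs : Fin n → ℝ)
    (A : (Fin n → Bool) → ℝ) (hA : ∀ σ, 0 ≤ A σ) :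
    0 ≤ gibbsRCW J β n t R hs A :=
  div_nonneg (Finset.sum_nonneg fun σ _ => mul_nonneg (hA σ) (Real.exp_pos _).le)
    (partition_pos J β n t R hs).le

lemma gibbsRCW_variance (J β : ℝ) (n : ℕ) (t R : ℝ) (hs : Fin n → ℝ)
    (A : (Fin n → Bool) → ℝ) :
    gibbsRCW J β n t R hs (fun σ => (A σ - gibbsRCW J β n t R hs A) ^ 2) =
      gibbsRCW J β n t R hs (fun σ => A σ ^ 2) - gibbsRCW J β n t R hs A ^ 2 := by
  have hZ := (partition_pos J β n t R hs).ne'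
  have hm : ∑ σ : Fin n → Bool, A σ * Real.exp (-(β * Hrcw J n t R hs σ)) =
      gibbsRCW J β n t R hs A * ∑ σ : Fin n → Bool, Real.exp (-(β * Hrcw J n t R hs σ)) := by
    rw [gibbsRCW, div_mul_cancel₀ _ hZ]
  generalize gibbsRCW J β n t R hs A = m at *
  have hsum : ∑ σ : Fin n → Bool, (A σ - m) ^ 2 * Real.exp (-(β * Hrcw J n t R hs σ)) =
      ∑ σ : Fin n → Bool, A σ ^ 2 * Real.exp (-(β * Hrcw J n t R hs σ)) -
        m ^ 2 * ∑ σ : Fin n → Bool, Real.exp (-(β * Hrcw J n t R hs σ)) := by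
    have : ∑ σ : Fin n → Bool, (A σ - m) ^ 2 * Real.exp (-(β * Hrcw J n t R hs σ)) =
        ∑ σ : Fin n → Bool, A σ ^ 2 * Real.exp (-(β * Hrcw J n t R hs σ)) -
        2 * m * ∑ σ : Fin n → Bool, A σ * Real.exp (-(β * Hrcw J n t R hs σ)) +
        m ^ 2 * ∑ σ : Fin n → Bool, Real.exp (-(β * Hrcw J n t R hs σ)) := by
      simp only [Finset.mul_sum, ← Finset.sum_sub_distrib, ← Finset.sum_add_distrib]
      exact Finset.sum_congr rfl fun σ _ => by ring
    rw [this, hm]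
    ring
  unfold gibbsRCW
  rw [hsum, sub_div, mul_div_cancel_right₀ _ hZ]

lemma continuous_gibbsRCW (J β : ℝ) (n : ℕ) (t : ℝ) (A : (Fin n → Bool) → ℝ) :
    Continuous fun p : ℝ × (Fin n → ℝ) => gibbsRCW J β n t p.1 p.2 A := by
  unfold gibbsRCW
  refine Continuous.div ?_ ?_ fun p => (partition_pos J β n t p.1 p.2).ne' <;>
  · unfold Hrcw
    fun_prop

lemma hasDerivAt_gibbsRCW_mag (J β : ℝ) {n : ℕ} (hn : 1 ≤ n) (t R : ℝ) (hs : Fin n → ℝ) :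
    HasDerivAt (fun r => gibbsRCW J β n t r hs (mag n))
      (β * J * n *
        gibbsRCW J β n t R hs (fun σ => (mag n σ - gibbsRCW J β n t R hs (mag n)) ^ 2)) R := by
  have hn0 : (n : ℝ) ≠ 0 := by positivity
  have hexp (σ : Fin n → Bool) :
      HasDerivAt (fun r => Real.exp (-(β * Hrcw J n t r hs σ)))
        (β * J * n * (mag n σ * Real.exp (-(β * Hrcw J n t R hs σ)))) R := by
    have hH : HasDerivAt (fun r => -(β * Hrcw J n t r hs σ)) (β * J * n * mag n σ) R := by
      have h := ((((((hasDerivAt_id R).const_mul J).mul_const (magSum n σ)).const_sub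
        ((1 - t) * (-(J / n) * pairSum n σ))).sub_const
          (∑ i : Fin n, hs i * spin (σ i))).const_mul β).neg
      refine h.congr_deriv ?_
      rw [mag]
      field_simp
    refine hH.exp.congr_deriv ?_
    ring
  have hZ := (partition_pos J β n t R hs).ne'
  have hden := HasDerivAt.fun_sum fun σ (_ : σ ∈ Finset.univ) => hexp σ
  have hnum := HasDerivAt.fun_sum fun σ (_ : σ ∈ Finset.univ) => (hexp σ).const_mul (mag n σ)
  refine (hnum.div hden hZ).congr_deriv ?_
  have hsq : ∑ σ : Fin n → Bool,
      mag n σ * (β * J * n * (mag n σ * Real.exp (-(β * Hrcw J n t R hs σ)))) =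
      β * J * n * ∑ σ : Fin n → Bool, mag n σ ^ 2 * Real.exp (-(β * Hrcw J n t R hs σ)) := by
    rw [Finset.mul_sum]
    exact Finset.sum_congr rfl fun σ _ => by ring
  rw [gibbsRCW_variance, hsq, ← Finset.mul_sum]
  unfold gibbsRCW
  field_simp

lemma continuous_gibbsRCW_variance (J β : ℝ) (n : ℕ) (t : ℝ) (A : (Fin n → Bool) → ℝ) :
    Continuous fun p : ℝ × (Fin n → ℝ) =>
      gibbsRCW J β n t p.1 p.2 (fun σ => (A σ - gibbsRCW J β n t p.1 p.2 A) ^ 2) := by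
  simp only [gibbsRCW_variance]
  exact (continuous_gibbsRCW J β n t _).sub ((continuous_gibbsRCW J β n t A).pow 2)

lemma abs_gibbsRCW_mag_variance_le (J β : ℝ) (n : ℕ) (t R : ℝ) (hs : Fin n → ℝ) :
    |gibbsRCW J β n t R hs (fun σ => (mag n σ - gibbsRCW J β n t R hs (mag n)) ^ 2)| ≤ 2 ^ 2 := by
  refine abs_gibbsRCW_le _ _ _ _ _ _ _ _ fun σ => ?_
  rw [abs_pow]
  have h₁ := abs_mag_le_one n σ
  have h₂ := abs_gibbsRCW_le J β n t R hs (mag n) 1 (abs_mag_le_one n)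
  have h₃ := abs_sub (mag n σ) (gibbsRCW J β n t R hs (mag n))
  exact pow_le_pow_left₀ (abs_nonneg _) (by linarith) 2

lemma intervalIntegral_comp_le_of_hasDerivAt {m V R R' : ℝ → ℝ} {a b c : ℝ} (hc : 0 < c)
    (hab : a ≤ b) (hm : ∀ r, HasDerivAt m (c * V r) r) (hmb : ∀ r, |m r| ≤ 1)
    (hV : Continuous V) (hV0 : ∀ r, 0 ≤ V r)
    (hderiv : ∀ ε, HasDerivAt R (R' ε) ε) (hcont : Continuous R')
    (hjac : ∀ ε ∈ Set.Icc a b, 1 ≤ R' ε) :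
    ∫ ε in a..b, V (R ε) ≤ 2 / c := by
  have hR : Continuous R := continuous_iff_continuousAt.2 fun ε => (hderiv ε).continuousAt
  have hVR : Continuous fun ε => c * V (R ε) := continuous_const.mul (hV.comp hR)
  have hint := intervalIntegral.integral_eq_sub_of_hasDerivAt (a := a) (b := b)
    (fun ε _ => (hm (R ε)).comp ε (hderiv ε)) ((hVR.mul hcont).intervalIntegrable a b)
  have hmono : ∫ ε in a..b, c * V (R ε) ≤ ∫ ε in a..b, c * V (R ε) * R' ε :=
    intervalIntegral.integral_mono_on hab (hVR.intervalIntegrable a b)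
      ((hVR.mul hcont).intervalIntegrable a b) fun ε hε =>
        le_mul_of_one_le_right (mul_nonneg hc.le (hV0 _)) (hjac ε hε)
  rw [hint, intervalIntegral.integral_const_mul] at hmono
  simp only [Function.comp_apply] at hmono
  rw [le_div_iff₀' hc]
  linarith [(abs_le.1 (hmb (R a))).1, (abs_le.1 (hmb (R b))).2]

lemma intervalIntegral_integral_le_of_forall {X : Type*} [MeasurableSpace X]
    (μ : Measure X) [IsProbabilityMeasure μ] {F : ℝ → X → ℝ} {a b B C : ℝ} (hab : a ≤ b)
    (hF : Measurable (Function.uncurry F)) (hF0 : ∀ ε x, 0 ≤ F ε x)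
    (hFB : ∀ ε x, |F ε x| ≤ B) (hFC : ∀ x, ∫ ε in a..b, F ε x ≤ C) :
    ∫ ε in a..b, ∫ x, F ε x ∂μ ≤ C := by
  rw [intervalIntegral_integral_swap]
  · calc ∫ x, (∫ ε in a..b, F ε x) ∂μ ≤ ∫ _, C ∂μ :=
          integral_mono_of_nonneg
            (ae_of_all _ fun x => intervalIntegral.integral_nonneg hab fun ε _ => hF0 ε x)
            (integrable_const _) (ae_of_all _ hFC)
      _ = C := by simp
  · rw [Set.uIoc_of_le hab]
    exact Integrable.of_bound hF.aestronglyMeasurable B (ae_of_all _ fun p => hFB p.1 p.2)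

/-- Thermal concentration of the magnetization for the random-field Curie-Weiss
interpolating model: if `ε ↦ R_ε(t)` is regular (C¹ diffeomorphism with Jacobian ≥ 1
on `[s_n, 2s_n]`), then
`∫_{s_n}^{2s_n} dε E⟨(M - ⟨M⟩_{t,ε})²⟩_{t,ε} ≤ 2/(βJn)`. -/
theorem curieWeiss_randomField_thermal_concentration (J β S : ℝ)
    (hJ : 0 < J) (hβ : 0 < β) (hS : 0 < S)
    (Ph : Measure ℝ) [IsProbabilityMeasure Ph]
    (hsupp : ∀ᵐ x ∂Ph, x ∈ Set.Icc (-S) S)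
    (n : ℕ) (hn : 1 ≤ n) (t : ℝ) (ht : t ∈ Set.Icc (0 : ℝ) 1)
    (sn : ℝ) (hsn : sn ∈ Set.Ioc (0 : ℝ) (1 / 2))
    (R R' : ℝ → ℝ)
    (hderiv : ∀ ε, HasDerivAt R (R' ε) ε)
    (hcont : Continuous R')
    (hjac : ∀ ε ∈ Set.Icc sn (2 * sn), 1 ≤ R' ε) :
    ∫ ε in sn..(2 * sn),
        ∫ hs : Fin n → ℝ,
          gibbsRCW J β n t (R ε) hs
            (fun σ => (mag n σ - gibbsRCW J β n t (R ε) hs (mag n)) ^ 2)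
        ∂(Measure.pi fun _ : Fin n => Ph)
      ≤ 2 / (β * J * n) := by
  have hle : sn ≤ 2 * sn := by linarith [hsn.1]
  have hR : Continuous R := continuous_iff_continuousAt.2 fun ε => (hderiv ε).continuousAt
  have hc : 0 < β * J * n := by positivity
  have hV := continuous_gibbsRCW_variance J β n t (mag n)
  have hV0 (r : ℝ) (hs : Fin n → ℝ) : 0 ≤ gibbsRCW J β n t r hs
      (fun σ => (mag n σ - gibbsRCW J β n t r hs (mag n)) ^ 2) :=
    gibbsRCW_nonneg _ _ _ _ _ _ _ fun σ => sq_nonneg _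
  have hVB := abs_gibbsRCW_mag_variance_le J β n t
  have hm (hs : Fin n → ℝ) (r : ℝ) := hasDerivAt_gibbsRCW_mag J β hn t r hs
  have hmb (hs : Fin n → ℝ) (r : ℝ) := abs_gibbsRCW_le J β n t r hs (mag n) 1 (abs_mag_le_one n)
  generalize hVdef : (fun (r : ℝ) (hs : Fin n → ℝ) => gibbsRCW J β n t r hs
    (fun σ => (mag n σ - gibbsRCW J β n t r hs (mag n)) ^ 2)) = V
  have hVapp (r : ℝ) (hs : Fin n → ℝ) : gibbsRCW J β n t r hs
      (fun σ => (mag n σ - gibbsRCW J β n t r hs (mag n)) ^ 2) = V r hs := by rw [← hVdef]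
  simp only [hVapp] at hV hV0 hVB hm ⊢
  have hVR : Continuous (Function.uncurry fun ε hs => V (R ε) hs) :=
    hV.comp ((hR.comp continuous_fst).prodMk continuous_snd)
  refine intervalIntegral_integral_le_of_forall _ hle hVR.measurable
    (fun ε hs => hV0 (R ε) hs) (fun ε hs => hVB (R ε) hs) fun hs => ?_
  exact intervalIntegral_comp_le_of_hasDerivAt hc hle (hm hs) (hmb hs)
    (hV.comp (continuous_id.prodMk continuous_const)) (fun r => hV0 r hs) hderiv hcont hjac
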